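/- arXiv:2011.03176 — 2 statements merged into one kernel-verified Lean document; each statement's English description precedes it below -/
import Mathlib

section
/- Suppose f satisfies Assumption 1, with global minimizer x*, and let u ∈ (0, 4/(2M − m)). Define V : ℝ^{2d} → ℝ by V(x, v) = ‖x − x*‖² + ‖x − x* + v‖² + 1, and b : ℝ^{2d} → ℝ^{2d} by b(x, v) = (v, −2v − u·∇f(x)). Then: (i) V ≥ 1 and V(x,v) → ∞ as ‖(x,v)‖ → ∞; (ii) there exist α > 0 and β > 0 with ⟨∇V(x,v), b(x,v)⟩ ≤ −α·V(x,v) + β for all (x,v); (iii) ‖∇V(x,v)‖² + ‖b(x,v)‖² ≤ max(26 + 2u²M², 30)·V(x,v) for all (x,v); (iv) sup_{(x,v)} ‖D²V(x,v)‖_op < ∞, and in fact ‖D²V(x,v)·(y,w)‖² ≤ 40·‖(y,w)‖² for all vectors (y,w). -/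
open MeasureTheory Filter Real
open scoped RealInnerProductSpace

noncomputable section

/-- Assumption 1 : `f` is `C²`, `m`-strongly convex with `M`-Lipschitz gradient. -/
structure Assumption1 (d : ℕ) (f : EuclideanSpace ℝ (Fin d) → ℝ) (m M : ℝ) : Prop where
  m_pos : 0 < m
  m_le_M : m ≤ M
  smooth : ContDiff ℝ 2 f
  hess_lower : ∀ x v, m * ‖v‖ ^ 2 ≤ iteratedFDeriv ℝ 2 f x ![v, v]
  hess_upper : ∀ x v, iteratedFDeriv ℝ 2 f x ![v, v] ≤ M * ‖v‖ ^ 2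

/-- The Lyapunov function `V(x,v) = ‖x-x*‖² + ‖x-x*+v‖² + 1` for the underdamped
Langevin diffusion. -/
def Vul (d : ℕ) (xstar : EuclideanSpace ℝ (Fin d))
    (x v : EuclideanSpace ℝ (Fin d)) : ℝ :=
  ‖x - xstar‖ ^ 2 + ‖x - xstar + v‖ ^ 2 + 1

/-- A symmetric bilinear form is bounded by any bound of its quadratic form. -/
theorem opNorm_le_of_symm_of_abs_apply_self_le {E : Type*} [NormedAddCommGroup E]
    [InnerProductSpace ℝ E] (B : E →L[ℝ] E →L[ℝ] ℝ) {K : ℝ} (hK : 0 ≤ K)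
    (hsymm : ∀ v w, B v w = B w v) (hB : ∀ v, |B v v| ≤ K * ‖v‖ ^ 2) : ‖B‖ ≤ K := by
  have polar : ∀ v w, |B v w| ≤ K / 2 * (‖v‖ ^ 2 + ‖w‖ ^ 2) := by
    intro v w
    have h₁ := abs_le.mp (hB (v + w))
    have h₂ := abs_le.mp (hB (v - w))
    have hpar := congrArg (K * ·) (parallelogram_law_with_norm ℝ v w)
    have hs := hsymm v w
    simp only [map_add, map_sub, add_apply, sub_apply] at h₁ h₂ hpar
    rw [abs_le]
    constructor <;> linarith [h₁.1, h₁.2, h₂.1, h₂.2]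
  refine B.opNorm_le_bound₂ hK fun v w => ?_
  rcases eq_or_ne v 0 with rfl | hv
  · simp
  rcases eq_or_ne w 0 with rfl | hw
  · simp
  have hpos : 0 < ‖v‖ * ‖w‖ := mul_pos (norm_pos_iff.mpr hv) (norm_pos_iff.mpr hw)
  have h := polar (‖w‖ • v) (‖v‖ • w)
  simp only [map_smul, smul_apply, smul_eq_mul, norm_smul, norm_norm, abs_mul, abs_norm] at h
  rw [Real.norm_eq_abs]
  refine le_of_mul_le_mul_left ?_ hpos
  linarith

/-- The gradient at `x` deviates from `(m + M) / 2 • (x - xstar)` by at most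
`(M - m) / 2 * ‖x - xstar‖`. -/
theorem Assumption1.norm_gradient_sub_le {d : ℕ} {f : EuclideanSpace ℝ (Fin d) → ℝ} {m M : ℝ}
    (hA : Assumption1 d f m M) {xstar : EuclideanSpace ℝ (Fin d)} (hmin : ∀ y, f xstar ≤ f y)
    (x : EuclideanSpace ℝ (Fin d)) :
    ‖gradient f x - ((m + M) / 2) • (x - xstar)‖ ≤ (M - m) / 2 * ‖x - xstar‖ := by
  have hdiff : Differentiable ℝ (fderiv ℝ f) :=
    (hA.smooth.fderiv_right (m := 1) (by norm_num)).differentiable (by norm_num)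
  have hstar : fderiv ℝ f xstar = 0 :=
    IsLocalMin.fderiv_eq_zero (Filter.Eventually.of_forall hmin)
  let L : EuclideanSpace ℝ (Fin d) →L[ℝ] EuclideanSpace ℝ (Fin d) →L[ℝ] ℝ :=
    ((m + M) / 2) • innerSL ℝ
  have hL : ∀ v w, L v w = (m + M) / 2 * ⟪v, w⟫ := fun _ _ => rfl
  have hderiv : ∀ y ∈ Set.univ, HasFDerivWithinAt (fun y => fderiv ℝ f y - L y)
      (fderiv ℝ (fderiv ℝ f) y - L) Set.univ y := fun y _ =>
    ((hdiff y).hasFDerivAt.sub L.hasFDerivAt).hasFDerivWithinAt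
  have hbound : ∀ y ∈ Set.univ, ‖fderiv ℝ (fderiv ℝ f) y - L‖ ≤ (M - m) / 2 := by
    intro y _
    refine opNorm_le_of_symm_of_abs_apply_self_le _ (by linarith [hA.m_le_M]) ?_ ?_
    · intro v w
      have hs : IsSymmSndFDerivAt ℝ f y :=
        hA.smooth.contDiffAt.isSymmSndFDerivAt (by simp)
      simp [hL, hs.eq v w, real_inner_comm v w]
    · intro v
      have hl := hA.hess_lower y v
      have hr := hA.hess_upper y v
      simp only [iteratedFDeriv_two_apply, Matrix.cons_val_zero, Matrix.cons_val_one] at hl hr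
      rw [sub_apply, sub_apply, hL, real_inner_self_eq_norm_sq, abs_le]
      constructor <;> linarith
  have h := Convex.norm_image_sub_le_of_norm_hasFDerivWithin_le hderiv hbound convex_univ
    (Set.mem_univ xstar) (Set.mem_univ x)
  convert h using 1
  rw [← (InnerProductSpace.toDual ℝ (EuclideanSpace ℝ (Fin d))).norm_map]
  congr 1
  ext w
  simp [gradient, hstar, hL]
  ring

/-- The gradient is Lipschitz at the minimizer. -/
theorem Assumption1.norm_gradient_le {d : ℕ} {f : EuclideanSpace ℝ (Fin d) → ℝ} {m M : ℝ}
    (hA : Assumption1 d f m M) {xstar : EuclideanSpace ℝ (Fin d)} (hmin : ∀ y, f xstar ≤ f y)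
    (x : EuclideanSpace ℝ (Fin d)) : ‖gradient f x‖ ≤ M * ‖x - xstar‖ := by
  have h := norm_le_norm_sub_add (gradient f x) (((m + M) / 2) • (x - xstar))
  rw [norm_smul, Real.norm_of_nonneg (by linarith [hA.m_pos, hA.m_le_M])] at h
  linarith [hA.norm_gradient_sub_le hmin x]

/-- For `0 < u < 4 / M` the map `x ↦ 2 (x - xstar) - u ∇f(x)` expands the distance to the
minimizer by a factor strictly below `2`. -/
theorem Assumption1.exists_norm_two_smul_sub_gradient_le {d : ℕ}
    {f : EuclideanSpace ℝ (Fin d) → ℝ} {m M : ℝ} (hA : Assumption1 d f m M)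
    {xstar : EuclideanSpace ℝ (Fin d)} (hmin : ∀ y, f xstar ≤ f y) {u : ℝ} (hu : 0 < u)
    (huM : u * M < 4) :
    ∃ c, 0 ≤ c ∧ c < 2 ∧ ∀ x, ‖(2 : ℝ) • (x - xstar) - u • gradient f x‖ ≤ c * ‖x - xstar‖ := by
  refine ⟨|2 - u * ((m + M) / 2)| + u * ((M - m) / 2), ?_, ?_, fun x => ?_⟩
  · have := mul_nonneg hu.le (sub_nonneg.mpr hA.m_le_M)
    linarith [abs_nonneg (2 - u * ((m + M) / 2))]
  · have hum := mul_pos hu hA.m_pos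
    rcases abs_cases (2 - u * ((m + M) / 2)) with h | h <;> linarith
  · have hsplit : (2 : ℝ) • (x - xstar) - u • gradient f x
        = (2 - u * ((m + M) / 2)) • (x - xstar)
          - u • (gradient f x - ((m + M) / 2) • (x - xstar)) := by
      module
    rw [hsplit]
    refine (norm_sub_le _ _).trans ?_
    rw [norm_smul, norm_smul, Real.norm_eq_abs, Real.norm_of_nonneg hu.le, add_mul, mul_assoc u]
    gcongr
    exact hA.norm_gradient_sub_le hmin x

/-- The squared norm of a sum is at most twice the sum of the squared norms. -/
theorem norm_add_sq_le_two_mul {E : Type*} [SeminormedAddCommGroup E] (a b : E) :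
    ‖a + b‖ ^ 2 ≤ 2 * (‖a‖ ^ 2 + ‖b‖ ^ 2) :=
  (pow_le_pow_left₀ (norm_nonneg _) (norm_add_le a b) 2).trans add_sq_le

theorem tendsto_Vul_cocompact (d : ℕ) (xstar : EuclideanSpace ℝ (Fin d)) :
    Filter.Tendsto (fun p : EuclideanSpace ℝ (Fin d) × EuclideanSpace ℝ (Fin d) =>
      Vul d xstar p.1 p.2) (Filter.cocompact _) Filter.atTop := by
  refine Filter.tendsto_atTop_mono (fun p => ?_) (Filter.tendsto_atTop_add_const_right _
    (-(1 + ‖xstar‖)) tendsto_norm_cocompact_atTop)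
  rw [← sub_eq_add_neg, sub_le_iff_le_add]
  obtain ⟨x, v⟩ := p
  have hx : ‖x‖ ≤ ‖x - xstar‖ + ‖xstar‖ := norm_le_norm_sub_add x xstar
  have hv : ‖v‖ ≤ ‖x - xstar + v‖ + ‖x - xstar‖ := by
    simpa using norm_sub_le (x - xstar + v) (x - xstar)
  have hpos := norm_nonneg xstar
  simp only [Prod.norm_def, Vul]
  refine max_le ?_ ?_ <;>
  nlinarith [sq_nonneg (‖x - xstar‖ - 1), sq_nonneg (‖x - xstar + v‖ - 1)]

/-- Lemma 2: Lyapunov properties for the underdamped Langevin drift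
`b(x,v) = (v, -2v - u∇f(x))`.  Here `∇V(x,v) = (2(x-x*) + 2(x-x*+v), 2(x-x*+v))`,
so the inner products with components of `b` are written out explicitly. -/
theorem lyapunov_underdamped (d : ℕ) (f : EuclideanSpace ℝ (Fin d) → ℝ) (m M : ℝ)
    (hA : Assumption1 d f m M)
    (xstar : EuclideanSpace ℝ (Fin d)) (hmin : ∀ y, f xstar ≤ f y)
    (u : ℝ) (hu : u ∈ Set.Ioo (0:ℝ) (4 / (2 * M - m))) :
    -- (i)
    (∀ x v, 1 ≤ Vul d xstar x v) ∧
    Filter.Tendsto (fun p : EuclideanSpace ℝ (Fin d) × EuclideanSpace ℝ (Fin d) =>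
      Vul d xstar p.1 p.2) (Filter.cocompact _) Filter.atTop ∧
    -- (ii): ⟪∇V(x,v), b(x,v)⟫ ≤ -α V(x,v) + β
    (∃ a : ℝ, 0 < a ∧ ∃ b : ℝ, 0 < b ∧ ∀ x v,
      ⟪(2:ℝ) • (x - xstar) + (2:ℝ) • (x - xstar + v), v⟫
        + ⟪(2:ℝ) • (x - xstar + v), -((2:ℝ) • v) - u • gradient f x⟫
      ≤ -a * Vul d xstar x v + b) ∧
    -- (iii): ‖∇V(x,v)‖² + ‖b(x,v)‖² ≤ max (26 + 2u²M²) 30 ⋅ V(x,v)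
    (∀ x v,
      ‖(2:ℝ) • (x - xstar) + (2:ℝ) • (x - xstar + v)‖ ^ 2
        + ‖(2:ℝ) • (x - xstar + v)‖ ^ 2
        + ‖v‖ ^ 2 + ‖-((2:ℝ) • v) - u • gradient f x‖ ^ 2
      ≤ max (26 + 2 * u ^ 2 * M ^ 2) 30 * Vul d xstar x v) ∧
    -- (iv): the Hessian of V is the constant matrix [[4I, 2I], [2I, 2I]];
    -- its operator norm is (uniformly) bounded
    (∀ y w : EuclideanSpace ℝ (Fin d),
      ‖(4:ℝ) • y + (2:ℝ) • w‖ ^ 2 + ‖(2:ℝ) • y + (2:ℝ) • w‖ ^ 2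
        ≤ 40 * (‖y‖ ^ 2 + ‖w‖ ^ 2)) := by
  obtain ⟨hu₀, hu₁⟩ := hu
  have hm := hA.m_pos
  have hmM := hA.m_le_M
  have huM : u * M < 4 := by
    rw [lt_div_iff₀ (by linarith)] at hu₁
    nlinarith
  refine ⟨fun x v => ?_, tendsto_Vul_cocompact d xstar, ?_, fun x v => ?_, fun y w => ?_⟩
  · unfold Vul
    linarith [sq_nonneg ‖x - xstar‖, sq_nonneg ‖x - xstar + v‖]
  · obtain ⟨c, hc₀, hc, hcx⟩ := hA.exists_norm_two_smul_sub_gradient_le hmin hu₀ huM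
    refine ⟨2 - c, by linarith, 2 - c, by linarith, fun x v => ?_⟩
    obtain ⟨w, rfl⟩ : ∃ w, v = w - (x - xstar) := ⟨x - xstar + v, by abel⟩
    have hg := hcx x
    unfold Vul
    generalize x - xstar = z at hg ⊢
    generalize gradient f x = g at hg ⊢
    rw [add_sub_cancel]
    have key : ⟪(2:ℝ) • z + (2:ℝ) • w, w - z⟫ + ⟪(2:ℝ) • w, -((2:ℝ) • (w - z)) - u • g⟫
        = -2 * (‖z‖ ^ 2 + ‖w‖ ^ 2) + 2 * ⟪w, (2:ℝ) • z - u • g⟫ := by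
      simp only [inner_add_left, inner_sub_right, inner_neg_right, real_inner_smul_left,
        real_inner_smul_right, real_inner_self_eq_norm_sq, real_inner_comm w z]
      ring
    have hcs : ⟪w, (2:ℝ) • z - u • g⟫ ≤ ‖w‖ * (c * ‖z‖) :=
      (real_inner_le_norm _ _).trans (by gcongr)
    have hcz : c * (2 * (‖w‖ * ‖z‖)) ≤ c * (‖z‖ ^ 2 + ‖w‖ ^ 2) := by
      gcongr
      linarith [two_mul_le_add_sq ‖z‖ ‖w‖]
    rw [key]
    linarith
  · have hg := hA.norm_gradient_le hmin x
    have hv : ‖v‖ ^ 2 ≤ 2 * (‖x - xstar + v‖ ^ 2 + ‖x - xstar‖ ^ 2) := by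
      have h := norm_add_sq_le_two_mul (x - xstar + v) (-(x - xstar))
      rwa [norm_neg, ← sub_eq_add_neg, add_sub_cancel_left] at h
    have hg₂ : ‖gradient f x‖ ^ 2 ≤ M ^ 2 * ‖x - xstar‖ ^ 2 := by
      rw [← mul_pow]
      gcongr
    have hug := mul_le_mul_of_nonneg_left hg₂ (sq_nonneg u)
    have h₁ := norm_add_sq_le_two_mul ((2:ℝ) • (x - xstar)) ((2:ℝ) • (x - xstar + v))
    have h₂ := norm_add_sq_le_two_mul (-((2:ℝ) • v)) (-(u • gradient f x))
    rw [← sub_eq_add_neg] at h₂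
    have hz := mul_le_mul_of_nonneg_right (le_max_left (26 + 2 * u ^ 2 * M ^ 2) 30)
      (sq_nonneg ‖x - xstar‖)
    have hw := mul_le_mul_of_nonneg_right (le_max_right (26 + 2 * u ^ 2 * M ^ 2) 30)
      (sq_nonneg ‖x - xstar + v‖)
    have hone := le_max_right (26 + 2 * u ^ 2 * M ^ 2) 30
    simp only [norm_neg, norm_smul, mul_pow, Real.norm_eq_abs, sq_abs] at h₁ h₂ ⊢
    unfold Vul
    linarith
  · have h₁ := norm_add_sq_le_two_mul ((4:ℝ) • y) ((2:ℝ) • w)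
    have h₂ := norm_add_sq_le_two_mul ((2:ℝ) • y) ((2:ℝ) • w)
    simp only [norm_smul, mul_pow, Real.norm_eq_abs, sq_abs] at h₁ h₂
    linarith [sq_nonneg ‖w‖]

end
end

section
/- Let f : ℝ^d → ℝ be differentiable, m-strongly convex and with M-Lipschitz gradient (0 < m ≤ M), and let x* be its global minimizer. Then for all x, v ∈ ℝ^d: 2·⟨∇f(x), x − x* + v⟩ ≥ m·‖x − x* + v‖² + m·‖x − x*‖² − M·‖v‖². Equivalently, with V(x,v) = ‖x − x*‖² + ‖x − x* + v‖² + 1 and b(x,v) = (v, −2v − u∇f(x)) for u > 0: ⟨∇V(x,v), b(x,v)⟩ ≤ −u·m·‖x − x* + v‖² − u·m·‖x − x*‖² − (2 − u·M)·‖v‖². -/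
open MeasureTheory Filter Real
open scoped RealInnerProductSpace

noncomputable section

/-- The descent lemma: a differentiable function whose gradient is `M`-Lipschitz lies below its
quadratic upper model of curvature `M`. -/
theorem descent_of_lipschitz_gradient {E : Type*} [NormedAddCommGroup E]
    [InnerProductSpace ℝ E] [CompleteSpace E] {f : E → ℝ} {M : ℝ} (hdiff : Differentiable ℝ f)
    (hlip : ∀ x y, ‖gradient f x - gradient f y‖ ≤ M * ‖x - y‖) (x v : E) :
    f (x + v) ≤ f x + ⟪gradient f x, v⟫ + M / 2 * ‖v‖ ^ 2 := by
  let φ : ℝ → ℝ := fun t => f (x + t • v) - t * ⟪gradient f x, v⟫ - M / 2 * ‖v‖ ^ 2 * t ^ 2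
  have hφ (t : ℝ) : HasDerivAt φ
      (⟪gradient f (x + t • v), v⟫ - ⟪gradient f x, v⟫ - M * ‖v‖ ^ 2 * t) t := by
    have hline : HasDerivAt (fun s : ℝ => x + s • v) v t := by
      simpa using ((hasDerivAt_id t).smul_const v).const_add x
    have hf := (hdiff (x + t • v)).hasGradientAt.hasFDerivAt.comp_hasDerivAt t hline
    have hlin := (hasDerivAt_id t).mul_const ⟪gradient f x, v⟫
    have hquad := ((hasDerivAt_id t).pow 2).const_mul (M / 2 * ‖v‖ ^ 2)
    refine ((hf.sub hlin).sub hquad).congr_deriv ?_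
    simp
    ring
  have hanti : AntitoneOn φ (Set.Icc 0 1) := by
    refine antitoneOn_of_deriv_nonpos (convex_Icc 0 1)
      (fun t _ => (hφ t).continuousAt.continuousWithinAt)
      (fun t _ => (hφ t).differentiableAt.differentiableWithinAt) fun t ht => ?_
    rw [interior_Icc] at ht
    rw [(hφ t).deriv, ← inner_sub_left, sub_nonpos]
    calc ⟪gradient f (x + t • v) - gradient f x, v⟫
        ≤ ‖gradient f (x + t • v) - gradient f x‖ * ‖v‖ := real_inner_le_norm _ _
      _ ≤ M * ‖x + t • v - x‖ * ‖v‖ := by gcongr; exact hlip _ _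
      _ = M * ‖v‖ ^ 2 * t := by
        rw [add_sub_cancel_left, norm_smul, Real.norm_of_nonneg ht.1.le]
        ring
  have h := hanti (Set.left_mem_Icc.2 zero_le_one) (Set.right_mem_Icc.2 zero_le_one) zero_le_one
  simp only [φ, one_smul, zero_smul, add_zero] at h
  linarith

/-- The key inequality for strongly convex, gradient-Lipschitz `f`, and its
consequence for the Lyapunov function `V(x,v) = ‖x-x*‖² + ‖x-x*+v‖² + 1` and the
underdamped Langevin drift `b(x,v) = (v, -2v - u∇f(x))` (whose inner product with
`∇V(x,v) = (2(x-x*) + 2(x-x*+v), 2(x-x*+v))` is written out explicitly). -/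
theorem strong_convexity_drift_inequality (d : ℕ)
    (f : EuclideanSpace ℝ (Fin d) → ℝ) (m M : ℝ) (hm : 0 < m) (hmM : m ≤ M)
    (hdiff : Differentiable ℝ f)
    (hconv : ∀ x y, f x + ⟪gradient f x, y - x⟫ + m / 2 * ‖y - x‖ ^ 2 ≤ f y)
    (hlip : ∀ x y, ‖gradient f x - gradient f y‖ ≤ M * ‖x - y‖)
    (xstar : EuclideanSpace ℝ (Fin d)) (hmin : ∀ y, f xstar ≤ f y)
    (hgrad0 : gradient f xstar = 0) :
    (∀ x v : EuclideanSpace ℝ (Fin d),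
      m * ‖x - xstar + v‖ ^ 2 + m * ‖x - xstar‖ ^ 2 - M * ‖v‖ ^ 2
        ≤ 2 * ⟪gradient f x, x - xstar + v⟫) ∧
    (∀ u : ℝ, 0 < u → ∀ x v : EuclideanSpace ℝ (Fin d),
      ⟪(2:ℝ) • (x - xstar) + (2:ℝ) • (x - xstar + v), v⟫
          + ⟪(2:ℝ) • (x - xstar + v), -((2:ℝ) • v) - u • gradient f x⟫
        ≤ -(u * m) * ‖x - xstar + v‖ ^ 2 - (u * m) * ‖x - xstar‖ ^ 2
            - (2 - u * M) * ‖v‖ ^ 2) := by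
  have key (x v : EuclideanSpace ℝ (Fin d)) :
      m * ‖x - xstar + v‖ ^ 2 + m * ‖x - xstar‖ ^ 2 - M * ‖v‖ ^ 2
        ≤ 2 * ⟪gradient f x, x - xstar + v⟫ := by
    have hdescent := descent_of_lipschitz_gradient hdiff hlip x v
    have hx := hconv x xstar
    have hxv := hconv xstar (x + v)
    rw [← neg_sub x xstar, inner_neg_right, norm_neg] at hx
    rw [hgrad0, inner_zero_left, add_sub_right_comm] at hxv
    rw [inner_add_right]
    linarith
  refine ⟨key, fun u hu x v => ?_⟩
  have h := mul_le_mul_of_nonneg_left (key x v) hu.le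
  generalize x - xstar = w at h ⊢
  have hdrift : ⟪(2 : ℝ) • w + (2 : ℝ) • (w + v), v⟫
      + ⟪(2 : ℝ) • (w + v), -((2 : ℝ) • v) - u • gradient f x⟫
        = -2 * ‖v‖ ^ 2 - u * (2 * ⟪gradient f x, w + v⟫) := by
    simp only [inner_add_left, inner_add_right, inner_sub_right, inner_neg_right,
      real_inner_smul_left, real_inner_smul_right, real_inner_self_eq_norm_sq,
      real_inner_comm (gradient f x)]
    ring
  rw [hdrift]
  linarith

end
end
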